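/- Let H be a virtually-full, virtually-coabelian subgroup of a direct product D = Γ_1 × … × Γ_n, where each Γ_i is finitely presented and n ≥ 3. Then H is finitely presented. -/

import Mathlib

open Subgroup

/-- Reduced word length in a free group. -/
noncomputable def fgNorm {X : Type*} (w : FreeGroup X) : ℕ :=
  @FreeGroup.norm X (Classical.decEq X) w

/-- `w` is a product of exactly `N` conjugates of elements of `R ∪ R⁻¹`. -/
def ExprOf {X : Type*} (R : Set (FreeGroup X)) (w : FreeGroup X) (N : ℕ) : Prop :=
  ∃ l : List (FreeGroup X × FreeGroup X),
    l.length = N ∧ (∀ p ∈ l, p.2 ∈ R ∨ p.2⁻¹ ∈ R) ∧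
    (l.map fun p => p.1 * p.2 * p.1⁻¹).prod = w

/-- The area of a null-homotopic word: the least number of conjugates of relators needed. -/
noncomputable def area {X : Type*} (R : Set (FreeGroup X)) (w : FreeGroup X) : ℕ :=
  sInf {N | ExprOf R w N}

/-- The Dehn function of the presentation with relator set `R`. -/
noncomputable def dehn {X : Type*} (R : Set (FreeGroup X)) (l : ℕ) : ℕ :=
  sSup {A | ∃ w ∈ Subgroup.normalClosure R, fgNorm w ≤ l ∧ A = area R w}

/-- `f ⪯ g`. -/
def Preceq (f g : ℕ → ℕ) : Prop := ∃ C : ℕ, ∀ l, f l ≤ C * g (C * l + C) + C * l + C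

/-- `f ≃ g`. -/
def FEquiv (f g : ℕ → ℕ) : Prop := Preceq f g ∧ Preceq g f

/-- `φ` realizes `⟨X | R⟩` as a presentation of `G`. -/
def Presents {X : Type*} {G : Type*} [Group G] (R : Set (FreeGroup X))
    (φ : FreeGroup X →* G) : Prop :=
  Function.Surjective φ ∧ φ.ker = Subgroup.normalClosure R

def FinitelyPresentedGroup (G : Type*) [Group G] : Prop :=
  ∃ (X : Type) (_ : Finite X) (R : Set (FreeGroup X)) (φ : FreeGroup X →* G),
    R.Finite ∧ Presents R φ

/-- `f` is an isoperimetric function for `G` : the Dehn function of every finite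
presentation of `G` is `⪯ f`. -/
def IsIsopFunction (G : Type*) [Group G] (f : ℕ → ℕ) : Prop :=
  ∀ (X : Type) (R : Set (FreeGroup X)) (φ : FreeGroup X →* G),
    Finite X → R.Finite → Presents R φ → Preceq (dehn R) f

/-- `(α, ρ)` is an area-radius pair for the presentation with relator set `R`. -/
def IsAreaRadiusPair {X : Type*} (R : Set (FreeGroup X)) (α ρ : ℕ → ℕ) : Prop :=
  ∀ w ∈ Subgroup.normalClosure R, ∀ l : ℕ, fgNorm w ≤ l →
    ∃ L : List (FreeGroup X × FreeGroup X), L.length ≤ α l ∧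
      (∀ p ∈ L, (p.2 ∈ R ∨ p.2⁻¹ ∈ R) ∧ fgNorm p.1 ≤ ρ l) ∧
      (L.map fun p => p.1 * p.2 * p.1⁻¹).prod = w

/-- `g` is a product of at most `k` elements of `S ∪ S⁻¹`. -/
def WordLe {G : Type*} [Group G] (S : Set G) (g : G) (k : ℕ) : Prop :=
  ∃ l : List G, l.length ≤ k ∧ (∀ x ∈ l, x ∈ S ∨ x⁻¹ ∈ S) ∧ l.prod = g

/-- Word length of `g` with respect to the generating set `S`. -/
noncomputable def wordLength {G : Type*} [Group G] (S : Set G) (g : G) : ℕ :=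
  sInf {k | WordLe S g k}

section FinitePresentation

variable {G H Q : Type*} [Group G] [Group H] [Group Q]

theorem Group.IsFinitelyPresented.group_fg [h : Group.IsFinitelyPresented G] : Group.FG G := by
  obtain ⟨n, φ, hφ, -⟩ := h.out
  exact Group.fg_of_surjective hφ

theorem Group.exists_finite_closure_eq_top (G : Type*) [Group G] [Group.FG G] :
    ∃ S : Set G, S.Finite ∧ closure S = ⊤ := by
  obtain ⟨S, h, hS⟩ := Group.fg_iff.1 ‹Group.FG G›
  exact ⟨S, hS, h⟩

theorem finitelyPresentedGroup_iff {G : Type*} [Group G] :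
    FinitelyPresentedGroup G ↔ Group.IsFinitelyPresented G := by
  constructor
  · rintro ⟨X, _, R, φ, hR, hφ, hker⟩
    exact Group.IsFinitelyPresented.of_surjective φ hφ ⟨R, hR, hker.symm⟩
  · rintro ⟨n, φ, hφ, R, hR, hker⟩
    exact ⟨Fin n, inferInstance, R, φ, hR, hφ, hker.symm⟩

/-- The kernel of a surjection from a finitely generated group onto a finitely presented group is
the normal closure of a finite set. -/
theorem MonoidHom.isFinitelyNormallyGenerated_ker [Group.FG G] [hQ : Group.IsFinitelyPresented Q]
    (π : G →* Q) (hπ : Function.Surjective π) : π.ker.IsFinitelyNormallyGenerated := by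
  obtain ⟨n, φ, hφ, S, hS, hSker⟩ := hQ.out
  obtain ⟨B, hB, hBtop⟩ := Group.exists_finite_closure_eq_top G
  choose σ hσ using hπ
  choose w hw using hφ
  let l : FreeGroup (Fin n) →* G := FreeGroup.lift fun i => σ (φ (FreeGroup.of i))
  have hl : ∀ x, π (l x) = φ x := by
    intro x
    have : π.comp l = φ := by ext i; simp [l, hσ]
    rw [← this]; rfl
  refine ⟨l '' S ∪ (fun b => (l (w (π b)))⁻¹ * b) '' B, (hS.image _).union (hB.image _), ?_⟩
  set V := normalClosure (l '' S ∪ (fun b => (l (w (π b)))⁻¹ * b) '' B) with hV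
  have hle : V ≤ π.ker := by
    refine normalClosure_le_normal ?_
    rintro _ (⟨s, hs, rfl⟩ | ⟨b, hb, rfl⟩)
    · have : s ∈ φ.ker := hSker ▸ subset_normalClosure hs
      simpa [hl] using this
    · simp [MonoidHom.mem_ker, hl, hw]
  refine le_antisymm hle fun e he => ?_
  have htop : l.range ⊔ V = ⊤ := by
    rw [eq_top_iff, ← hBtop, closure_le]
    intro b hb
    have h2 : (l (w (π b)))⁻¹ * b ∈ V := subset_normalClosure (Or.inr ⟨b, hb, rfl⟩)
    have := mul_mem (mem_sup_left (T := V) ⟨w (π b), rfl⟩ : l (w (π b)) ∈ l.range ⊔ V)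
      (mem_sup_right h2)
    simpa using this
  have heT : e ∈ l.range ⊔ V := htop ▸ mem_top e
  obtain ⟨_, ⟨x, rfl⟩, v, hv, rfl⟩ := mem_sup_of_normal_right.1 heT
  have hx : x ∈ φ.ker := by
    have h3 := hle hv
    rw [MonoidHom.mem_ker] at h3 he ⊢
    rw [map_mul, h3, hl, mul_one] at he
    exact he
  have hcomap : φ.ker ≤ V.comap l := by
    rw [← hSker]
    exact normalClosure_le_normal fun s hs => subset_normalClosure (Or.inl ⟨s, hs, rfl⟩)
  exact mul_mem (hcomap hx) hv

/-- A normal subgroup that is finitely generated up to conjugation by a subgroup containing it is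
the normal closure of a finite set. -/
theorem Subgroup.IsFinitelyNormallyGenerated.of_subgroup {N : Subgroup G} [hN : N.Normal]
    {K : Subgroup G} (hNK : N ≤ K) (h : (N.subgroupOf K).IsFinitelyNormallyGenerated) :
    N.IsFinitelyNormallyGenerated := by
  obtain ⟨S, hS, hSN⟩ := h
  refine ⟨K.subtype '' S, hS.image _, le_antisymm ?_ ?_⟩
  · refine normalClosure_le_normal ?_
    rintro _ ⟨s, hs, rfl⟩
    have : s ∈ N.subgroupOf K := hSN ▸ subset_normalClosure hs
    exact this
  · have : N.subgroupOf K ≤ (normalClosure (K.subtype '' S)).comap K.subtype := by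
      rw [← hSN]
      exact normalClosure_le_normal fun s hs => subset_normalClosure ⟨s, hs, rfl⟩
    intro x hx
    exact this (x := ⟨x, hNK hx⟩) hx

/-- If a subgroup has finite index, then a subgroup which is finitely generated up to conjugation
by the whole group is so up to conjugation by the subgroup. -/
theorem Subgroup.IsFinitelyNormallyGenerated.subgroupOf {N : Subgroup G}
    (h : N.IsFinitelyNormallyGenerated) {K : Subgroup G} [K.FiniteIndex] (hNK : N ≤ K) :
    (N.subgroupOf K).IsFinitelyNormallyGenerated := by
  obtain ⟨S, hS, rfl⟩ := h
  obtain ⟨T, hT, -⟩ := K.exists_isComplement_right 1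
  have hTfin : T.Finite := hT.finite_right
  refine ⟨K.subtype ⁻¹' ((fun p : G × G => p.1 * p.2 * p.1⁻¹) '' (T ×ˢ S)),
    ((hTfin.prod hS).image _).preimage K.subtype_injective.injOn, le_antisymm ?_ ?_⟩
  · refine normalClosure_le_normal ?_
    rintro x ⟨⟨t, s⟩, ⟨ht, hs⟩, hx⟩
    change (x : G) ∈ normalClosure S
    rw [← Subgroup.coe_subtype, ← hx]
    exact normalClosure_normal.conj_mem _ (subset_normalClosure hs) _
  · set V := normalClosure (K.subtype ⁻¹' ((fun p : G × G => p.1 * p.2 * p.1⁻¹) '' (T ×ˢ S)))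
    have : normalClosure S ≤ V.map K.subtype := by
      rw [normalClosure, closure_le]
      intro x hx
      obtain ⟨s, hs, hsx⟩ := Group.mem_conjugatesOfSet_iff.1 hx
      obtain ⟨g, rfl⟩ := isConj_iff.1 hsx
      obtain ⟨⟨k, t⟩, hkt, -⟩ := isComplement_iff_existsUnique.1 hT g
      simp only at hkt
      have hmem : t.1 * s * t.1⁻¹ ∈ K :=
        hNK (normalClosure_normal.conj_mem _ (subset_normalClosure hs) _)
      have hV : (⟨t.1 * s * t.1⁻¹, hmem⟩ : K) ∈ V :=
        subset_normalClosure ⟨(t.1, s), ⟨t.2, hs⟩, rfl⟩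
      refine ⟨k * ⟨t.1 * s * t.1⁻¹, hmem⟩ * k⁻¹, normalClosure_normal.conj_mem _ hV _, ?_⟩
      rw [← hkt]
      simp [mul_assoc]
    rintro ⟨x, hxK⟩ hx
    obtain ⟨y, hy, hyx⟩ := this hx
    have : y = ⟨x, hxK⟩ := Subtype.ext hyx
    exact this ▸ hy

/-- A finitely generated free group is finitely presented. -/
theorem IsFreeGroup.isFinitelyPresented [IsFreeGroup G] [Group.FG G] :
    Group.IsFinitelyPresented G := by
  classical
  obtain ⟨S, hS, hS_top⟩ := Group.exists_finite_closure_eq_top G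
  let e := IsFreeGroup.toFreeGroup G
  have hfin : (⋃ s ∈ S, {x | x ∈ (e s).toWord.map Prod.fst}).Finite :=
    hS.biUnion fun s _ => List.finite_toSet _
  set Y := ⋃ s ∈ S, {x | x ∈ (e s).toWord.map Prod.fst} with hY
  have huniv : Y = Set.univ := by
    by_contra hne
    obtain ⟨x, hx⟩ := (Set.ne_univ_iff_exists_notMem _).1 hne
    let f : FreeGroup (IsFreeGroup.Generators G) →* Multiplicative ℤ :=
      FreeGroup.lift fun y => if y = x then Multiplicative.ofAdd 1 else 1
    have hker : (⊤ : Subgroup G) ≤ (f.comp e.toMonoidHom).ker := by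
      rw [← hS_top, closure_le]
      intro s hs
      have : f (e s) = 1 := by
        rw [← FreeGroup.mk_toWord (x := e s), FreeGroup.lift_mk]
        refine List.prod_eq_one fun z hz => ?_
        obtain ⟨⟨y, b⟩, hyb, rfl⟩ := List.mem_map.1 hz
        have hyx : y ≠ x := by
          rintro rfl
          exact hx (Set.mem_biUnion hs (List.mem_map.2 ⟨_, hyb, rfl⟩))
        cases b <;> simp [hyx]
      exact this
    have h1 : f (e (e.symm (FreeGroup.of x))) = 1 := hker (mem_top (e.symm (FreeGroup.of x)))
    rw [MulEquiv.apply_symm_apply] at h1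
    simp only [f, FreeGroup.lift_apply_of, if_true] at h1
    exact absurd h1 (by decide)
  have : Finite (IsFreeGroup.Generators G) := Set.finite_univ_iff.1 (huniv ▸ hfin)
  exact Group.IsFinitelyPresented.equiv e.symm

/-- A finite-index subgroup of a finitely presented group is finitely presented. -/
theorem Group.IsFinitelyPresented.of_finiteIndex [hG : Group.IsFinitelyPresented G]
    (K : Subgroup G) [K.FiniteIndex] : Group.IsFinitelyPresented K := by
  obtain ⟨n, φ, hφ, hker⟩ := hG.out
  have : (K.comap φ).FiniteIndex := ⟨by
    rw [index_comap_of_surjective K hφ]; exact FiniteIndex.index_ne_zero⟩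
  have hfp : Group.IsFinitelyPresented (K.comap φ) := IsFreeGroup.isFinitelyPresented
  have hsurj : Function.Surjective (φ.subgroupComap K) := by
    rintro ⟨k, hk⟩
    obtain ⟨x, rfl⟩ := hφ k
    exact ⟨⟨x, hk⟩, rfl⟩
  refine Group.IsFinitelyPresented.of_surjective (φ.subgroupComap K) hsurj ?_
  have hle : φ.ker ≤ K.comap φ := fun x hx => by
    rw [mem_comap, (MonoidHom.mem_ker).1 hx]; exact one_mem K
  convert hker.subgroupOf hle using 1
  ext x
  rw [MonoidHom.mem_ker, mem_subgroupOf, MonoidHom.mem_ker, Subtype.ext_iff]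
  rfl

end FinitePresentation

section Extensions

variable {G H Q : Type*} [Group G] [Group H] [Group Q]

theorem Group.fg_of_ker_fg [Group.FG Q] (q : G →* Q) (hq : Function.Surjective q)
    (hker : q.ker.FG) : Group.FG G := by
  obtain ⟨S, hS, hS_top⟩ := Group.exists_finite_closure_eq_top Q
  choose σ hσ using hq
  refine Group.fg_def.2 ?_
  have hT : (closure (σ '' S)).FG := (Subgroup.fg_iff _).2 ⟨_, rfl, hS.image _⟩
  convert hT.sup hker
  refine (eq_top_iff.2 fun g _ => ?_).symm
  have : q g ∈ (closure (σ '' S)).map q := by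
    have himg : q '' (σ '' S) = S := by rw [Set.image_image]; simp [hσ]
    rw [MonoidHom.map_closure, himg, hS_top]
    exact mem_top _
  obtain ⟨x, hx, hxg⟩ := this
  have h2 : x⁻¹ * g ∈ q.ker := by simp [MonoidHom.mem_ker, hxg]
  simpa using mul_mem (mem_sup_left (T := q.ker) hx) (mem_sup_right h2)

theorem Subgroup.closure_normal_of_conj_mem {S B : Set G} (hS : closure S = ⊤)
    (h : ∀ s ∈ S, ∀ b ∈ B, s * b * s⁻¹ ∈ closure B ∧ s⁻¹ * b * s ∈ closure B) :
    (closure B).Normal := by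
  have key : ∀ g : G, (∀ b ∈ B, g * b * g⁻¹ ∈ closure B) →
      ∀ w ∈ closure B, g * w * g⁻¹ ∈ closure B := by
    intro g hg
    have : closure B ≤ (closure B).comap (MulAut.conj g).toMonoidHom := by
      rw [closure_le]
      intro b hb
      simpa using hg b hb
    intro w hw
    simpa using this hw
  have hall : ∀ g : G, ∀ w ∈ closure B, g * w * g⁻¹ ∈ closure B ∧ g⁻¹ * w * g ∈ closure B := by
    intro g
    have hg : g ∈ closure S := hS ▸ mem_top g
    induction hg using closure_induction with
    | mem s hs =>
      refine fun w hw => ⟨key s (fun b hb => (h s hs b hb).1) w hw, ?_⟩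
      simpa using key s⁻¹ (fun b hb => by simpa using (h s hs b hb).2) w hw
    | one => simp
    | mul x y _ _ hx hy =>
      refine fun w hw => ⟨?_, ?_⟩
      · simpa [mul_assoc] using (hx _ (hy w hw).1).1
      · simpa [mul_assoc] using (hy _ (hx w hw).2).2
    | inv x _ hx => exact fun w hw => ⟨by simpa using (hx w hw).2, by simpa using (hx w hw).1⟩
  exact ⟨fun w hw g => (hall g w hw).1⟩

/-- A finitely generated group which is an extension of a finitely presented group by a finitely
generated group is covered by a finitely presented group which is also such an extension. -/
theorem Group.IsFinitelyPresented.exists_cover [Group.FG H] [hQ : Group.IsFinitelyPresented Q]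
    (q : H →* Q) (hq : Function.Surjective q) (hker : q.ker.FG) :
    ∃ (E : Type) (_ : Group E) (π : E →* H), Group.IsFinitelyPresented E ∧
      Function.Surjective π ∧ (q.comp π).ker.FG := by
  obtain ⟨α, _, ψ, hψ⟩ := Group.fg_iff_exists_freeGroup_hom_surjective_finite.1 ‹Group.FG H›
  obtain ⟨X, hX, hXtop⟩ := Group.exists_finite_closure_eq_top (FreeGroup α)
  obtain ⟨B, hBker, hB⟩ := (Subgroup.fg_iff _).1 hker
  obtain ⟨S, hS, hSker⟩ :=
    MonoidHom.isFinitelyNormallyGenerated_ker (q.comp ψ) (hq.comp hψ)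
  choose σ hσ using hψ
  set B₀ := σ '' B with hB₀
  have hmap : (closure B₀).map ψ = q.ker := by
    rw [MonoidHom.map_closure, hB₀, Set.image_image]
    simp [hσ, hBker]
  have hlift : ∀ u, ∃ w, u ∈ (q.comp ψ).ker → w ∈ closure B₀ ∧ ψ w = ψ u := by
    intro u
    by_cases hu : u ∈ (q.comp ψ).ker
    · have : ψ u ∈ (closure B₀).map ψ := hmap ▸ hu
      obtain ⟨w, hw, hwu⟩ := this
      exact ⟨w, fun _ => ⟨hw, hwu⟩⟩
    · exact ⟨1, fun h => absurd h hu⟩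
  choose w hw using hlift
  have hB₀ker : ∀ b ∈ B₀, b ∈ (q.comp ψ).ker := fun b hb => by
    have : ψ b ∈ q.ker := hmap ▸ mem_map_of_mem ψ (subset_closure hb)
    exact this
  let U := S ∪ (Set.image2 (fun x b => x * b * x⁻¹) X B₀ ∪
    Set.image2 (fun x b => x⁻¹ * b * x) X B₀)
  have hB₀fin : B₀.Finite := hB.image _
  have hUfin : U.Finite := hS.union ((hX.image2 _ hB₀fin).union (hX.image2 _ hB₀fin))
  have hU : ∀ u ∈ U, u ∈ (q.comp ψ).ker := by
    rintro u (hu | ⟨x, hx, b, hb, rfl⟩ | ⟨x, hx, b, hb, rfl⟩)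
    · exact hSker ▸ subset_normalClosure hu
    · exact (MonoidHom.normal_ker _).conj_mem _ (hB₀ker b hb) _
    · simpa using (MonoidHom.normal_ker (q.comp ψ)).conj_mem _ (hB₀ker b hb) x⁻¹
  set V := normalClosure ((fun u => u * (w u)⁻¹) '' U) with hV
  have hVψ : V ≤ ψ.ker := by
    refine normalClosure_le_normal ?_
    rintro _ ⟨u, hu, rfl⟩
    simp [MonoidHom.mem_ker, (hw u (hU u hu)).2]
  let mk := QuotientGroup.mk' V
  have hmk : ∀ u ∈ U, mk u ∈ closure (mk '' B₀) := by
    intro u hu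
    have h1 : mk (u * (w u)⁻¹) = 1 :=
      (QuotientGroup.eq_one_iff _).2 (subset_normalClosure ⟨u, hu, rfl⟩)
    rw [map_mul, map_inv, mul_inv_eq_one] at h1
    rw [h1, ← MonoidHom.map_closure]
    exact mem_map_of_mem mk (hw u (hU u hu)).1
  have hnormal : (closure (mk '' B₀)).Normal := by
    refine closure_normal_of_conj_mem (S := mk '' X) ?_ ?_
    · rw [← MonoidHom.map_closure, hXtop, ← MonoidHom.range_eq_map]
      exact MonoidHom.range_eq_top.2 (QuotientGroup.mk'_surjective V)
    · rintro _ ⟨x, hx, rfl⟩ _ ⟨b, hb, rfl⟩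
      have h1 := hmk (x * b * x⁻¹) (Or.inr (Or.inl ⟨x, hx, b, hb, rfl⟩))
      have h2 := hmk (x⁻¹ * b * x) (Or.inr (Or.inr ⟨x, hx, b, hb, rfl⟩))
      exact ⟨by simpa only [map_mul, map_inv] using h1, by simpa only [map_mul, map_inv] using h2⟩
  refine ⟨FreeGroup α ⧸ V, inferInstance, QuotientGroup.lift V ψ hVψ,
    Group.IsFinitelyPresented.quotient V ⟨_, hUfin.image _, rfl⟩,
    fun h => ⟨mk (σ h), hσ h⟩, (Subgroup.fg_iff _).2 ⟨mk '' B₀, ?_, hB₀fin.image _⟩⟩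
  refine le_antisymm ?_ ?_
  · rw [closure_le]
    rintro _ ⟨b, hb, rfl⟩
    exact hB₀ker b hb
  · have hle : (q.comp ψ).ker ≤ (closure (mk '' B₀)).comap mk := by
      rw [← hSker]
      exact normalClosure_le_normal fun s hs => hmk s (Or.inl hs)
    intro e he
    obtain ⟨u, rfl⟩ := QuotientGroup.mk'_surjective V e
    exact hle he

/-- An extension of a finitely presented group by a finitely presented group is finitely
presented. -/
theorem Group.IsFinitelyPresented.of_extension [hQ : Group.IsFinitelyPresented Q]
    (q : G →* Q) (hq : Function.Surjective q) (hker : Group.IsFinitelyPresented q.ker) :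
    Group.IsFinitelyPresented G := by
  have hQfg : Group.FG Q := hQ.group_fg
  have hkfg : q.ker.FG := (Group.fg_iff_subgroup_fg _).1 hker.group_fg
  have hG : Group.FG G := Group.fg_of_ker_fg q hq hkfg
  obtain ⟨E, _, π, hE, hπ, hfg⟩ := Group.IsFinitelyPresented.exists_cover q hq hkfg
  have : Group.FG (q.comp π).ker := (Group.fg_iff_subgroup_fg _).2 hfg
  let θ : (q.comp π).ker →* q.ker :=
    (π.comp (q.comp π).ker.subtype).codRestrict q.ker fun x => x.2
  have hθ : Function.Surjective θ := by
    rintro ⟨y, hy⟩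
    obtain ⟨x, rfl⟩ := hπ y
    exact ⟨⟨x, hy⟩, rfl⟩
  have hle : π.ker ≤ (q.comp π).ker := fun x hx => by
    rw [MonoidHom.mem_ker] at hx
    simp [MonoidHom.mem_ker, hx]
  refine Group.IsFinitelyPresented.of_surjective π hπ (.of_subgroup hle ?_)
  convert MonoidHom.isFinitelyNormallyGenerated_ker θ hθ using 1
  ext x
  rw [mem_subgroupOf, MonoidHom.mem_ker, MonoidHom.mem_ker, Subtype.ext_iff]
  rfl

/-- A group with a finitely presented subgroup of finite index is finitely presented. -/
theorem Group.IsFinitelyPresented.of_finiteIndex_subgroup (K : Subgroup G) [K.FiniteIndex]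
    [Group.IsFinitelyPresented K] : Group.IsFinitelyPresented G := by
  have h1 : Group.IsFinitelyPresented (K.normalCore.subgroupOf K) :=
    Group.IsFinitelyPresented.of_finiteIndex _
  have h2 : Group.IsFinitelyPresented K.normalCore :=
    h1.equiv (subgroupOfEquivOfLe K.normalCore_le)
  refine Group.IsFinitelyPresented.of_extension (QuotientGroup.mk' K.normalCore)
    (QuotientGroup.mk'_surjective _) ?_
  rwa [QuotientGroup.ker_mk']

theorem Group.IsFinitelyPresented.prod [Group.IsFinitelyPresented G]
    [Group.IsFinitelyPresented H] : Group.IsFinitelyPresented (G × H) := by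
  refine Group.IsFinitelyPresented.of_extension (MonoidHom.snd G H) Prod.snd_surjective ?_
  let e : G ≃* (MonoidHom.snd G H).ker :=
    { toFun := fun g => ⟨(g, 1), rfl⟩
      invFun := fun x => x.1.1
      left_inv := fun _ => rfl
      right_inv := fun x => Subtype.ext (Prod.ext rfl x.2.symm)
      map_mul' := fun a b => Subtype.ext (Prod.ext rfl (mul_one _).symm) }
  exact Group.IsFinitelyPresented.equiv e

theorem Group.IsFinitelyPresented.pi {ι : Type*} [Finite ι] :
    ∀ (Γ : ι → Type*) [∀ i, Group (Γ i)], (∀ i, Group.IsFinitelyPresented (Γ i)) →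
      Group.IsFinitelyPresented (∀ i, Γ i) := by
  induction ι using Finite.induction_empty_option with
  | of_equiv e ih =>
    intro Γ _ h
    have := ih (fun i => Γ (e i)) fun i => h (e i)
    exact Group.IsFinitelyPresented.equiv
      { (Equiv.piCongrLeft Γ e) with
        map_mul' := fun x y => by
          ext i
          obtain ⟨j, rfl⟩ := e.surjective i
          simp [Equiv.piCongrLeft_apply_apply] }
  | h_empty => intro Γ _ _; infer_instance
  | h_option ih =>
    intro Γ _ h
    have h1 := ih (fun i => Γ (some i)) fun i => h (some i)
    have h0 := h none
    have := Group.IsFinitelyPresented.prod (G := Γ none) (H := ∀ i, Γ (some i))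
    exact Group.IsFinitelyPresented.equiv (G := Γ none × ∀ i, Γ (some i))
      { Equiv.piOptionEquivProd.symm with
        map_mul' := fun x y => by ext (_ | i) <;> rfl }

end Extensions

section NoetherianAction

variable {E V : Type*} [Group E] [CommGroup V]

/-- An action of a group on an abelian group, viewed as a representation over `ℤ`. -/
def intRepresentation (ρ : E →* MulAut V) : Representation ℤ E (Additive V) where
  toFun g := (MonoidHom.toAdditive (ρ g).toMonoidHom).toIntLinearMap
  map_one' := by ext; simp
  map_mul' x y := by ext; simp

/-- Subgroups stable under the action are submodules over the group ring. -/
def stableSubmodule (ρ : E →* MulAut V) (U : Subgroup V) (hU : ∀ e, ∀ u ∈ U, ρ e u ∈ U) :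
    Submodule (MonoidAlgebra ℤ E) (intRepresentation ρ).asModule where
  carrier := {x | ((intRepresentation ρ).asModuleEquiv x).toMul ∈ U}
  zero_mem' := by simp
  add_mem' := fun {a b} ha hb => by simpa using mul_mem ha hb
  smul_mem' := by
    intro r x hx
    induction r using MonoidAlgebra.induction_linear with
    | zero => simp
    | add r s hr hs => rw [add_smul]; simpa using mul_mem hr hs
    | single g t =>
      have h := zpow_mem (hU g _ hx) t
      rw [Set.mem_ofPred_eq, Representation.asModuleEquiv_map_smul,
        Representation.asAlgebraHom_single]
      exact h

theorem mem_stableSubmodule {ρ : E →* MulAut V} {U : Subgroup V}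
    {hU : ∀ e, ∀ u ∈ U, ρ e u ∈ U} {x : (intRepresentation ρ).asModule} :
    x ∈ stableSubmodule ρ U hU ↔ ((intRepresentation ρ).asModuleEquiv x).toMul ∈ U :=
  Iff.rfl

/-- The subgroup underlying a submodule over the group ring. -/
def subgroupOfSubmodule (ρ : E →* MulAut V)
    (P : Submodule (MonoidAlgebra ℤ E) (intRepresentation ρ).asModule) : Subgroup V where
  carrier := {v | (intRepresentation ρ).asModuleEquiv.symm (Additive.ofMul v) ∈ P}
  one_mem' := by simp
  mul_mem' := fun {a b} ha hb => by
    change (intRepresentation ρ).asModuleEquiv.symm (Additive.ofMul (a * b)) ∈ P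
    rw [ofMul_mul, map_add]
    exact P.add_mem ha hb
  inv_mem' := fun {a} ha => by
    change (intRepresentation ρ).asModuleEquiv.symm (Additive.ofMul a⁻¹) ∈ P
    rw [ofMul_inv, map_neg]
    exact P.neg_mem ha

theorem mem_subgroupOfSubmodule {ρ : E →* MulAut V}
    {P : Submodule (MonoidAlgebra ℤ E) (intRepresentation ρ).asModule} {v : V} :
    v ∈ subgroupOfSubmodule ρ P ↔
      (intRepresentation ρ).asModuleEquiv.symm (Additive.ofMul v) ∈ P :=
  Iff.rfl

theorem apply_mem_subgroupOfSubmodule {ρ : E →* MulAut V}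
    {P : Submodule (MonoidAlgebra ℤ E) (intRepresentation ρ).asModule} (e : E) {v : V}
    (hv : v ∈ subgroupOfSubmodule ρ P) : ρ e v ∈ subgroupOfSubmodule ρ P := by
  rw [mem_subgroupOfSubmodule] at hv
  have h := P.smul_mem (MonoidAlgebra.of ℤ E e) hv
  rw [← Representation.asModuleEquiv_symm_map_rho] at h
  exact h

/-- If a finitely generated group acts on an abelian group `V` with commutators acting trivially,
and `V` is generated as a group with action by a finite set, then so is every stable subgroup. -/
theorem exists_finite_stable_generators [Group.FG E] (ρ : E →* MulAut V)
    (hρ : commutator E ≤ ρ.ker) {S : Set V} (hS : S.Finite)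
    (hgen : ∀ U : Subgroup V, S ⊆ U → (∀ e, ∀ u ∈ U, ρ e u ∈ U) → U = ⊤)
    (C : Subgroup V) (hC : ∀ e, ∀ u ∈ C, ρ e u ∈ C) :
    ∃ T : Set V, T ⊆ C ∧ T.Finite ∧
      ∀ U : Subgroup V, T ⊆ U → (∀ e, ∀ u ∈ U, ρ e u ∈ U) → C ≤ U := by
  let ρ' : Abelianization E →* MulAut V := QuotientGroup.lift _ ρ hρ
  have hst : ∀ U : Subgroup V, (∀ e, ∀ u ∈ U, ρ e u ∈ U) → ∀ e, ∀ u ∈ U, ρ' e u ∈ U := by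
    intro U hU e
    obtain ⟨e, rfl⟩ := QuotientGroup.mk_surjective e
    exact hU e
  let m : Additive V ≃+ (intRepresentation ρ').asModule :=
    (intRepresentation ρ').asModuleEquiv.symm.toAddEquiv
  have hfg : Group.FG (Abelianization E) := QuotientGroup.fg _
  have hnoeth : IsNoetherianRing (MonoidAlgebra ℤ (Abelianization E)) :=
    Algebra.FiniteType.isNoetherianRing ℤ _
  have hfin : Module.Finite (MonoidAlgebra ℤ (Abelianization E))
      (intRepresentation ρ').asModule := by
    refine ⟨Submodule.fg_def.2
      ⟨(fun s : V => m (Additive.ofMul s)) '' S, hS.image _, ?_⟩⟩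
    let B : Set (intRepresentation ρ').asModule := (fun s : V => m (Additive.ofMul s)) '' S
    change Submodule.span _ B = ⊤
    set P := Submodule.span (MonoidAlgebra ℤ (Abelianization E)) B
    have hBP : B ⊆ P := Submodule.subset_span
    have h := hgen (subgroupOfSubmodule ρ' P) (fun s hs => hBP ⟨s, hs, rfl⟩)
      (fun e u hu => apply_mem_subgroupOfSubmodule (Abelianization.of e) hu)
    rw [eq_top_iff]
    intro x _
    obtain ⟨v, rfl⟩ := m.surjective x
    have hx : v.toMul ∈ subgroupOfSubmodule ρ' P := h ▸ mem_top _
    exact hx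
  have hN : IsNoetherian (MonoidAlgebra ℤ (Abelianization E))
    (intRepresentation ρ').asModule := inferInstance
  obtain ⟨T, hT, hTC⟩ := Submodule.fg_def.1 (hN.noetherian (stableSubmodule ρ' C (hst C hC)))
  refine ⟨(fun s : V => m (Additive.ofMul s)) ⁻¹' T, fun v hv => ?_,
    hT.preimage (m.injective.comp Additive.ofMul.injective).injOn, fun U hTU hU c hc => ?_⟩
  · have : m (Additive.ofMul v) ∈ stableSubmodule ρ' C (hst C hC) :=
      hTC ▸ Submodule.subset_span hv
    simpa [mem_stableSubmodule, m] using this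
  · have hle : stableSubmodule ρ' C (hst C hC) ≤ stableSubmodule ρ' U (hst U hU) := by
      rw [← hTC, Submodule.span_le]
      intro t ht
      obtain ⟨v, rfl⟩ := m.surjective t
      have h := hTU (a := v.toMul) ht
      simpa [mem_stableSubmodule, m] using h
    have h := hle (x := m (Additive.ofMul c)) (by simpa [mem_stableSubmodule, m] using hc)
    simpa [mem_stableSubmodule, m] using h

end NoetherianAction

section FibreProduct

open scoped commutatorElement

/-- A central extension of a free group splits off its kernel, which therefore meets the commutator
subgroup trivially. -/
theorem IsFreeGroup.eq_one_of_mem_ker_of_mem_commutator {M N : Type*} [Group M] [Group N]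
    [IsFreeGroup N] (θ : M →* N) (hθ : Function.Surjective θ) (hcent : θ.ker ≤ center M) {c : M}
    (hc : c ∈ θ.ker) (hc' : c ∈ commutator M) : c = 1 := by
  choose σ hσ using hθ
  let s : N →* M := IsFreeGroup.lift fun a => σ (IsFreeGroup.of a)
  have hs : ∀ x, θ (s x) = x := by
    have : θ.comp s = MonoidHom.id N := by
      apply IsFreeGroup.ext_hom
      intro a
      simp [s, hσ]
    exact fun x => DFunLike.congr_fun this x
  have hker : ∀ m, m * (s (θ m))⁻¹ ∈ center M := fun m =>
    hcent (by simp [MonoidHom.mem_ker, hs])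
  let r : M →* center M := MonoidHom.mk' (fun m => ⟨m * (s (θ m))⁻¹, hker m⟩) fun a b => by
    ext
    have := mem_center_iff.1 (hker b) (a * (s (θ a))⁻¹)
    have h := mem_center_iff.1 (hker b) (s (θ a))⁻¹
    simp only [map_mul, mul_inv_rev, mul_assoc, Subgroup.coe_mul] at h ⊢
    rw [h]
  have hr : commutator M ≤ r.ker := by
    rw [commutator_def, commutator_le]
    intro a _ b _
    rw [MonoidHom.mem_ker, map_commutatorElement, commutatorElement_eq_one_iff_mul_comm]
    exact Subtype.ext (mem_center_iff.1 (r b).2 _)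
  have h1 : r c = 1 := hr hc'
  have h2 := congrArg Subtype.val h1
  rw [MonoidHom.mem_ker] at hc
  simpa [r, hc] using h2

variable {H G F : Type*} [Group H] [Group G] [Group F]

theorem Subgroup.commutator_normalClosure_closure_eq_bot {E : Type*} [Group E] {S B : Set E}
    (hB : (closure B).Normal) (h : ∀ s ∈ S, ∀ b ∈ B, s * b = b * s) :
    ⁅normalClosure S, closure B⁆ = ⊥ := by
  rw [commutator_eq_bot_iff_le_centralizer]
  refine normalClosure_le_normal fun s hs => ?_
  rw [SetLike.mem_coe, centralizer_closure]
  exact mem_centralizer_iff.2 fun b hb => (h s hs b hb).symm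

theorem Group.IsFinitelyPresented.exists_cover_commuting [Group.FG H]
    [Group.IsFinitelyPresented G] [Group.IsFinitelyPresented F]
    (p : H →* G) (q : H →* F) (hp : Function.Surjective p) (hq : Function.Surjective q)
    (hpq : p.ker ⊓ q.ker = ⊥) (hker : q.ker.FG) :
    ∃ (E : Type) (_ : Group E) (π : E →* H), Group.IsFinitelyPresented E ∧
      Function.Surjective π ∧ ⁅(p.comp π).ker, (q.comp π).ker⁆ = ⊥ := by
  obtain ⟨E, _, π, hE, hπ, hfg⟩ := Group.IsFinitelyPresented.exists_cover q hq hker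
  have hEfg : Group.FG E := hE.group_fg
  obtain ⟨B, hB, hBfin⟩ := (Subgroup.fg_iff _).1 hfg
  obtain ⟨S, hS, hSM⟩ := MonoidHom.isFinitelyNormallyGenerated_ker (p.comp π) (hp.comp hπ)
  let R : Set E := (fun x : E × E => ⁅x.1, x.2⁆) '' S ×ˢ B
  have hR : R.Finite := (hS.prod hBfin).image _
  have hRπ : normalClosure R ≤ π.ker := by
    refine normalClosure_le_normal ?_
    rintro _ ⟨⟨s, b⟩, ⟨hs, hb⟩, rfl⟩
    have h1 : (p.comp π) s = 1 :=
      (MonoidHom.mem_ker (f := p.comp π)).1 (hSM ▸ subset_normalClosure hs)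
    have h2 : (q.comp π) b = 1 := (MonoidHom.mem_ker (f := q.comp π)).1 (hB ▸ subset_closure hb)
    have h3 : π ⁅s, b⁆ ∈ p.ker ⊓ q.ker := by
      simp only [MonoidHom.comp_apply] at h1 h2
      simp [MonoidHom.mem_ker, map_commutatorElement, h1, h2]
    rw [hpq] at h3
    exact h3
  let π' : E ⧸ normalClosure R →* H := QuotientGroup.lift _ π hRπ
  let mk := QuotientGroup.mk' (normalClosure R)
  have hmk : Function.Surjective mk := QuotientGroup.mk'_surjective _
  have hE' : Group.IsFinitelyPresented (E ⧸ normalClosure R) :=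
    Group.IsFinitelyPresented.of_surjective mk hmk ⟨R, hR, (QuotientGroup.ker_mk' _).symm⟩
  have hkerp : (p.comp π').ker = (p.comp π).ker.map mk :=
    (map_comap_eq_self_of_surjective hmk _).symm
  have hkerq : (q.comp π').ker = (q.comp π).ker.map mk :=
    (map_comap_eq_self_of_surjective hmk _).symm
  refine ⟨_, _, π', hE', fun h => ?_, ?_⟩
  · obtain ⟨e, rfl⟩ := hπ h
    exact ⟨mk e, rfl⟩
  · rw [hkerp, hkerq, ← hSM, map_normalClosure _ _ hmk, ← hB, MonoidHom.map_closure]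
    refine commutator_normalClosure_closure_eq_bot ?_ ?_
    · rw [← MonoidHom.map_closure, hB]
      exact Normal.map inferInstance _ hmk
    · rintro _ ⟨s, hs, rfl⟩ _ ⟨b, hb, rfl⟩
      rw [← commutatorElement_eq_one_iff_mul_comm, ← map_commutatorElement]
      exact (QuotientGroup.eq_one_iff _).2 (subset_normalClosure ⟨(s, b), ⟨hs, hb⟩, rfl⟩)

/-- The conjugation action on the abelianization of a normal subgroup. -/
def conjAbelianization {E : Type*} [Group E] (M : Subgroup E) [M.Normal] :
    E →* MulAut (Abelianization M) where
  toFun e := (MulAut.conjNormal e : MulAut M).abelianizationCongr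
  map_one' := by
    ext x
    obtain ⟨x, rfl⟩ := QuotientGroup.mk_surjective x
    exact congrArg Abelianization.of (by simp : (MulAut.conjNormal (1 : E) : MulAut M) x = x)
  map_mul' a b := by
    ext x
    obtain ⟨x, rfl⟩ := QuotientGroup.mk_surjective x
    exact congrArg Abelianization.of
      (by simp : (MulAut.conjNormal (a * b) : MulAut M) x =
        MulAut.conjNormal a (MulAut.conjNormal b x))

theorem conjAbelianization_of {E : Type*} [Group E] (M : Subgroup E) [M.Normal] (e : E) (x : M) :
    conjAbelianization M e (Abelianization.of x) = Abelianization.of (MulAut.conjNormal e x) :=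
  rfl

theorem le_ker_conjAbelianization {E : Type*} [Group E] (M : Subgroup E) [M.Normal] :
    M ≤ (conjAbelianization M).ker := by
  intro m hm
  rw [MonoidHom.mem_ker]
  ext x
  obtain ⟨x, rfl⟩ := QuotientGroup.mk_surjective x
  have : (MulAut.conjNormal m x : M) = ⟨m, hm⟩ * x * ⟨m, hm⟩⁻¹ := by ext; simp
  change conjAbelianization M m (Abelianization.of x) = Abelianization.of x
  rw [conjAbelianization_of, this]
  simp

theorem mem_ker_conjAbelianization_of_commute {E : Type*} [Group E] (M : Subgroup E) [M.Normal]
    {e : E} (he : ∀ m ∈ M, e * m = m * e) : e ∈ (conjAbelianization M).ker := by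
  rw [MonoidHom.mem_ker]
  ext x
  obtain ⟨x, rfl⟩ := QuotientGroup.mk_surjective x
  have : (MulAut.conjNormal e x : M) = x := by ext; simp [he x x.2]
  change conjAbelianization M e (Abelianization.of x) = Abelianization.of x
  rw [conjAbelianization_of, this]

end FibreProduct

section SubdirectProduct

open scoped commutatorElement

variable {H G F : Type*} [Group H] [Group G] [Group F]

/-- A subdirect product of a finitely presented group and a free group of finite rank, with
finitely generated kernel and central quotient, is finitely presented. -/
theorem Group.IsFinitelyPresented.of_subdirect_free
    [Group.IsFinitelyPresented G] [IsFreeGroup F] [Group.FG F]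
    (p : H →* G) (q : H →* F) (hp : Function.Surjective p) (hq : Function.Surjective q)
    (hpq : p.ker ⊓ q.ker = ⊥) (hcomm : ∀ a b : H, ⁅a, b⁆ ∈ p.ker ⊔ q.ker)
    (hker : q.ker.FG) : Group.IsFinitelyPresented H := by
  have hF : Group.IsFinitelyPresented F := IsFreeGroup.isFinitelyPresented
  have hH : Group.FG H := Group.fg_of_ker_fg q hq hker
  obtain ⟨E, _, π, hE, hπ, hMW⟩ :=
    Group.IsFinitelyPresented.exists_cover_commuting p q hp hq hpq hker
  have hEfg : Group.FG E := hE.group_fg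
  refine Group.IsFinitelyPresented.of_surjective π hπ ?_
  set M := (p.comp π).ker with hM
  have hcommute : ∀ w ∈ (q.comp π).ker, ∀ m ∈ M, w * m = m * w := fun w hw m hm =>
    mem_centralizer_iff.1 (commutator_eq_bot_iff_le_centralizer.1 hMW hm) w hw
  have hCM : π.ker ≤ M := fun c hc => by
    rw [MonoidHom.mem_ker] at hc
    simp [hM, MonoidHom.mem_ker, hc]
  have hCW : π.ker ≤ (q.comp π).ker := fun c hc => by
    rw [MonoidHom.mem_ker] at hc
    simp [MonoidHom.mem_ker, hc]
  obtain ⟨S, hS, hSM⟩ := MonoidHom.isFinitelyNormallyGenerated_ker (p.comp π) (hp.comp hπ)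
  have hact : commutator E ≤ (conjAbelianization M).ker := by
    rw [commutator_def, commutator_le]
    intro a _ b _
    have hab := hcomm (π a) (π b)
    obtain ⟨k, hk, l, hl, hkl⟩ := mem_sup_of_normal_right.1 hab
    obtain ⟨m, rfl⟩ := hπ k
    have h1 : m ∈ (conjAbelianization M).ker := le_ker_conjAbelianization M hk
    have h2 : m⁻¹ * ⁅a, b⁆ ∈ (conjAbelianization M).ker := by
      refine mem_ker_conjAbelianization_of_commute M (hcommute _ ?_)
      have : π (m⁻¹ * ⁅a, b⁆) = l := by
        rw [map_mul, map_commutatorElement, ← hkl, map_inv, inv_mul_cancel_left]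
      rw [MonoidHom.mem_ker, MonoidHom.comp_apply, this]
      exact hl
    simpa using mul_mem h1 h2
  have hstable : ∀ X : Subgroup E, X.Normal → ∀ e, ∀ u ∈ (X.subgroupOf M).map Abelianization.of,
      conjAbelianization M e u ∈ (X.subgroupOf M).map Abelianization.of := by
    rintro X hX e _ ⟨x, hx, rfl⟩
    rw [conjAbelianization_of]
    exact ⟨_, by simpa [mem_subgroupOf] using hX.conj_mem _ hx e, rfl⟩
  have hgen : ∀ U : Subgroup (Abelianization M),
      Abelianization.of '' (M.subtype ⁻¹' S) ⊆ U →
      (∀ e, ∀ u ∈ U, conjAbelianization M e u ∈ U) → U = ⊤ := by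
    intro U hU hst
    have hnorm : ((U.comap Abelianization.of).map M.subtype).Normal := by
      refine ⟨?_⟩
      rintro _ ⟨x, hx, rfl⟩ e
      exact ⟨MulAut.conjNormal e x, hst e _ hx, by simp⟩
    have hle : M ≤ (U.comap Abelianization.of).map M.subtype := by
      refine hSM.symm.le.trans (normalClosure_le_normal fun s hs => ?_)
      have hsM : s ∈ M := by
        rw [hM, ← hSM]
        exact subset_normalClosure hs
      exact ⟨⟨s, hsM⟩, hU ⟨⟨s, hsM⟩, hs, rfl⟩, rfl⟩
    rw [eq_top_iff]
    intro x _
    obtain ⟨x, rfl⟩ := QuotientGroup.mk_surjective x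
    obtain ⟨y, hy, hyx⟩ := hle x.2
    rw [Subtype.ext hyx] at hy
    exact hy
  obtain ⟨T, hTC, hT, hTU⟩ := exists_finite_stable_generators (conjAbelianization M) hact
    ((hS.preimage M.subtype_injective.injOn).image _) hgen
    ((π.ker.subgroupOf M).map Abelianization.of) (hstable _ inferInstance)
  choose! τ hτC hτ using fun t (ht : t ∈ T) => hTC ht
  refine ⟨(fun t => (τ t : E)) '' T, hT.image _, ?_⟩
  set K := normalClosure ((fun t => (τ t : E)) '' T) with hK
  have hKC : K ≤ π.ker := by
    refine normalClosure_le_normal ?_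
    rintro _ ⟨t, ht, rfl⟩
    exact hτC t ht
  refine le_antisymm hKC fun c hc => ?_
  have hCK := hTU ((K.subgroupOf M).map Abelianization.of)
    (fun t ht => ⟨τ t, subset_normalClosure ⟨t, ht, rfl⟩, hτ t ht⟩)
    (hstable _ normalClosure_normal)
  obtain ⟨k, hk, hkc⟩ := hCK ⟨⟨c, hCM hc⟩, hc, rfl⟩
  let θ : M →* (q.comp π).range := (q.comp π).rangeRestrict.comp M.subtype
  have hθ : θ.ker ≤ center M := by
    intro x hx
    rw [mem_center_iff]
    intro y
    have hx' : (q.comp π) x = 1 := congrArg Subtype.val hx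
    exact Subtype.ext (hcommute x hx' y y.2).symm
  have hone : k⁻¹ * ⟨c, hCM hc⟩ = 1 := by
    refine IsFreeGroup.eq_one_of_mem_ker_of_mem_commutator θ.rangeRestrict
      θ.rangeRestrict_surjective (by rwa [MonoidHom.ker_rangeRestrict]) ?_ ?_
    · rw [MonoidHom.ker_rangeRestrict]
      refine mul_mem (inv_mem ?_) ?_
      · exact Subtype.ext (hCW (hKC hk))
      · exact Subtype.ext (hCW hc)
    · rw [← Abelianization.ker_of, MonoidHom.mem_ker, map_mul, map_inv, hkc, inv_mul_cancel]
  have := congrArg Subtype.val (inv_mul_eq_one.1 hone)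
  rw [← show (k : E) = c from this]
  exact hk

/-- A subdirect product of two finitely presented groups, with finitely generated kernel and
central quotient, is finitely presented. -/
theorem Group.IsFinitelyPresented.of_subdirect
    [hG : Group.IsFinitelyPresented G] [hF : Group.IsFinitelyPresented F]
    (p : H →* G) (q : H →* F) (hp : Function.Surjective p) (hq : Function.Surjective q)
    (hpq : p.ker ⊓ q.ker = ⊥) (hcomm : ∀ a b : H, ⁅a, b⁆ ∈ p.ker ⊔ q.ker)
    (hker : q.ker.FG) : Group.IsFinitelyPresented H := by
  obtain ⟨n, r, hr, hrker⟩ := hF.out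
  let P : Subgroup (H × FreeGroup (Fin n)) :=
    (q.comp (MonoidHom.fst _ _)).eqLocus (r.comp (MonoidHom.snd _ _))
  let p' : P →* G := (p.comp (MonoidHom.fst _ _)).comp P.subtype
  let q' : P →* FreeGroup (Fin n) := (MonoidHom.snd _ _).comp P.subtype
  let f : P →* H := (MonoidHom.fst _ _).comp P.subtype
  have hP : ∀ x : P, q x.1.1 = r x.1.2 := fun x => x.2
  have hf : Function.Surjective f := fun h => by
    obtain ⟨c, hc⟩ := hr (q h)
    exact ⟨⟨(h, c), hc.symm⟩, rfl⟩
  have hq' : Function.Surjective q' := fun c => by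
    obtain ⟨h, hh⟩ := hq (r c)
    exact ⟨⟨(h, c), hh⟩, rfl⟩
  let j : q.ker →* P :=
    { toFun := fun h => ⟨(h, 1), by
        change q h = r 1
        rw [map_one]
        exact h.2⟩
      map_one' := rfl
      map_mul' := fun a b => by ext <;> simp }
  have hj : j.range = q'.ker := by
    ext x
    constructor
    · rintro ⟨h, rfl⟩
      rfl
    · intro hx
      have hx2 : x.1.2 = 1 := hx
      refine ⟨⟨x.1.1, ?_⟩, ?_⟩
      · rw [MonoidHom.mem_ker, hP, hx2, map_one]
      · exact Subtype.ext (Prod.ext rfl hx2.symm)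
  have hker' : q'.ker.FG := by
    rw [← hj, ← Group.fg_iff_subgroup_fg]
    have := (Group.fg_iff_subgroup_fg _).2 hker
    infer_instance
  have hP' : Group.IsFinitelyPresented P := by
    refine Group.IsFinitelyPresented.of_subdirect_free p' q' (hp.comp hf) hq' ?_ ?_ hker'
    · rw [eq_bot_iff]
      rintro x ⟨hx1, hx2⟩
      have hx2 : x.1.2 = 1 := hx2
      have hx1 : x.1.1 ∈ p.ker ⊓ q.ker := 
        ⟨hx1, (hP x).trans (by rw [hx2, map_one])⟩
      rw [hpq] at hx1
      exact Subtype.ext (Prod.ext hx1 hx2)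
    · intro a b
      obtain ⟨k, hk, l, hl, hkl⟩ := mem_sup_of_normal_right.1 (hcomm (f a) (f b))
      have hl' : j ⟨l, hl⟩ ∈ q'.ker := rfl
      have hk' : ⁅a, b⁆ * (j ⟨l, hl⟩)⁻¹ ∈ p'.ker := by
        have : f (⁅a, b⁆ * (j ⟨l, hl⟩)⁻¹) = k := by
          rw [map_mul, map_inv, map_commutatorElement, ← hkl]
          exact mul_inv_cancel_right k l
        have h : p (f (⁅a, b⁆ * (j ⟨l, hl⟩)⁻¹)) = 1 := by rwa [this]
        exact h
      simpa using mul_mem (mem_sup_left (T := q'.ker) hk') (mem_sup_right hl')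
  refine Group.IsFinitelyPresented.of_surjective f hf ?_
  obtain ⟨R, hR, hRr⟩ := hrker
  have hinj : Set.InjOn q' f.ker := fun x hx y hy hxy =>
    Subtype.ext (Prod.ext (((MonoidHom.mem_ker (f := f)).1 hx).trans
      ((MonoidHom.mem_ker (f := f)).1 hy).symm) hxy)
  let T : Set P := f.ker ∩ q' ⁻¹' R
  have hT : T ⊆ f.ker := Set.inter_subset_left
  have hTR : q' '' T = R := by
    refine (Set.image_inter_preimage _ _ _).trans (Set.inter_eq_right.2 fun c hc => ?_)
    have hc' : r c = 1 := (MonoidHom.mem_ker (f := r)).1 (hRr ▸ subset_normalClosure hc)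
    exact ⟨⟨(1, c), (map_one q).trans hc'.symm⟩, rfl, rfl⟩
  refine ⟨T, Set.Finite.of_finite_image (hTR ▸ hR) (hinj.mono hT), ?_⟩
  have hle : normalClosure T ≤ f.ker := normalClosure_le_normal hT
  refine le_antisymm hle fun x hx => ?_
  have hxr : q' x ∈ (normalClosure T).map q' := by
    rw [map_normalClosure _ _ hq', hTR, hRr, MonoidHom.mem_ker]
    refine (hP x).symm.trans ?_
    rw [show x.1.1 = 1 from hx, map_one]
  obtain ⟨y, hy, hyx⟩ := hxr
  rwa [← hinj (hle hy) hx hyx]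

end SubdirectProduct

section Product

open scoped commutatorElement

/-- The kernel of a homomorphism from a finitely generated group to an abelian group is the normal
closure of a finite set. -/
theorem MonoidHom.isFinitelyNormallyGenerated_ker_of_comm {P A : Type*} [Group P] [CommGroup A]
    [Group.FG P] (f : P →* A) : f.ker.IsFinitelyNormallyGenerated := by
  have hfg : Group.FG (Abelianization P) := QuotientGroup.fg _
  have hcomm : (commutator P).IsFinitelyNormallyGenerated := by
    obtain ⟨S, hS, hS_top⟩ := Group.exists_finite_closure_eq_top P
    refine ⟨(fun x : P × P => ⁅x.1, x.2⁆) '' S ×ˢ S, (hS.prod hS).image _, le_antisymm ?_ ?_⟩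
    · refine normalClosure_le_normal ?_
      rintro _ ⟨x, -, rfl⟩
      exact commutator_mem_commutator (mem_top _) (mem_top _)
    · set V := normalClosure ((fun x : P × P => ⁅x.1, x.2⁆) '' S ×ˢ S) with hV
      have hmk := QuotientGroup.mk'_surjective V
      have htop : closure (QuotientGroup.mk' V '' S) = ⊤ := by
        rw [← MonoidHom.map_closure, hS_top, map_top_of_surjective _ hmk]
      have h := commutator_normalClosure_closure_eq_bot (S := QuotientGroup.mk' V '' S)
        (B := QuotientGroup.mk' V '' S) (htop ▸ inferInstance) <| by
          rintro _ ⟨s, hs, rfl⟩ _ ⟨b, hb, rfl⟩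
          rw [← commutatorElement_eq_one_iff_mul_comm, ← map_commutatorElement]
          exact (QuotientGroup.eq_one_iff _).2 (subset_normalClosure ⟨(s, b), ⟨hs, hb⟩, rfl⟩)
      have htop' : normalClosure (QuotientGroup.mk' V '' S) = ⊤ :=
        eq_top_iff.2 (htop.ge.trans closure_le_normalClosure)
      rw [htop, htop', ← map_top_of_surjective _ hmk, ← map_commutator, ← commutator_def,
        Subgroup.map_eq_bot_iff, QuotientGroup.ker_mk'] at h
      exact h
  have hfin : Module.Finite ℤ (Additive (Abelianization P)) :=
    Module.Finite.iff_addGroup_fg.2 inferInstance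
  have hnoeth : IsNoetherian ℤ (Additive (Abelianization P)) := inferInstance
  have hsub : ∀ N : Subgroup (Abelianization P), N.FG := fun N => by
    rw [Subgroup.fg_iff_add_fg, ← AddSubgroup.toIntSubmodule_toAddSubgroup N.toAddSubgroup,
      ← Submodule.fg_iff_addSubgroup_fg]
    exact hnoeth.noetherian _
  have hker : (Abelianization.lift f).ker.IsFinitelyNormallyGenerated := by
    have := (Group.fg_iff_subgroup_fg _).2 (hsub (Abelianization.lift f).ker)
    exact Subgroup.IsFinitelyNormallyGenerated.of_FG _
  have h := hker.comap (f := Abelianization.of) QuotientGroup.mk_surjective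
    (by rwa [Abelianization.ker_of])
  exact h

/-- A subdirect product of two finitely generated groups is finitely generated if it intersects one
factor in the normal closure of a finite set. -/
theorem Group.fg_of_subdirect {W P Q : Type*} [Group W] [Group P] [Group Q] [Group.FG P]
    [Group.FG Q] (u : W →* P) (v : W →* Q) (hu : Function.Surjective u)
    (hv : Function.Surjective v) (huv : u.ker ⊓ v.ker = ⊥)
    (h : (v.ker.map u).IsFinitelyNormallyGenerated) : Group.FG W := by
  obtain ⟨S, hS, hSker⟩ := h
  obtain ⟨A, hA, hAtop⟩ := Group.exists_finite_closure_eq_top P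
  obtain ⟨B, hB, hBtop⟩ := Group.exists_finite_closure_eq_top Q
  have hS' : ∀ s ∈ S, ∃ w ∈ v.ker, u w = s := fun s hs => by
    have : s ∈ v.ker.map u := hSker ▸ subset_normalClosure hs
    exact this
  choose! σ hσ hσS using hS'
  choose α hα using hu
  choose β hβ using hv
  refine Group.fg_iff.2 ⟨α '' A ∪ β '' B ∪ σ '' S, ?_, ((hA.image _).union (hB.image _)).union
    (hS.image _)⟩
  set L := closure (α '' A ∪ β '' B ∪ σ '' S)
  have hLu : L.map u = ⊤ := by
    rw [eq_top_iff, ← hAtop, closure_le]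
    exact fun a ha => ⟨α a, subset_closure (Or.inl (Or.inl ⟨a, ha, rfl⟩)), hα a⟩
  have hLv : L.map v = ⊤ := by
    rw [eq_top_iff, ← hBtop, closure_le]
    exact fun b hb => ⟨β b, subset_closure (Or.inl (Or.inr ⟨b, hb, rfl⟩)), hβ b⟩
  have hnorm : ((L ⊓ v.ker).map u).Normal := by
    refine ⟨?_⟩
    rintro _ ⟨x, ⟨hxL, hxv⟩, rfl⟩ g
    obtain ⟨l, hl, rfl⟩ : g ∈ L.map u := hLu ▸ mem_top g
    exact ⟨l * x * l⁻¹, ⟨L.mul_mem (L.mul_mem hl hxL) (L.inv_mem hl),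
      (MonoidHom.normal_ker v).conj_mem _ hxv _⟩, by simp⟩
  have hle : v.ker ≤ L := by
    intro x hx
    have h1 : v.ker.map u ≤ (L ⊓ v.ker).map u := by
      rw [← hSker]
      exact normalClosure_le_normal fun s hs =>
        ⟨σ s, ⟨subset_closure (Or.inr ⟨s, hs, rfl⟩), hσ s hs⟩, hσS s hs⟩
    obtain ⟨y, ⟨hyL, hyv⟩, hyx⟩ := h1 ⟨x, hx, rfl⟩
    have h2 : y⁻¹ * x ∈ u.ker ⊓ v.ker :=
      ⟨by simp [hyx], v.ker.mul_mem (v.ker.inv_mem hyv) hx⟩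
    rw [huv, mem_bot, inv_mul_eq_one] at h2
    exact h2 ▸ hyL
  rw [← sup_eq_left.2 hle, ← comap_map_eq, hLv, comap_top]

variable {ι : Type*} {Γ : ι → Type*} [∀ i, Group (Γ i)] {A : Type*} [CommGroup A]

/-- The projection of the kernel of a homomorphism from a product to a subproduct. -/
def MonoidHom.kerRestrict (ψ : (∀ i, Γ i) →* A) (s : Set ι) : ψ.ker →* ∀ j : s, Γ j :=
  (MonoidHom.pi fun j : s => Pi.evalMonoidHom Γ j).comp ψ.ker.subtype

@[simp]
theorem MonoidHom.kerRestrict_apply (ψ : (∀ i, Γ i) →* A) (s : Set ι) (x : ψ.ker) (j : s) :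
    ψ.kerRestrict s x j = x.1 j :=
  rfl

theorem MonoidHom.kerRestrict_surjective [DecidableEq ι] (ψ : (∀ i, Γ i) →* A) {s : Set ι} {k : ι}
    (hk : k ∉ s) (hψ : Function.Surjective (ψ.comp (MonoidHom.mulSingle Γ k))) :
    Function.Surjective (ψ.kerRestrict s) := by
  classical
  intro y
  let x : ∀ i, Γ i := fun i => if h : i ∈ s then y ⟨i, h⟩ else 1
  obtain ⟨γ, hγ⟩ := hψ (ψ x)⁻¹
  refine ⟨⟨x * MonoidHom.mulSingle Γ k γ, ?_⟩, ?_⟩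
  · rw [MonoidHom.mem_ker, map_mul]
    exact mul_eq_one_iff_eq_inv'.2 hγ
  · ext j
    have : j.1 ≠ k := fun h => hk (h ▸ j.2)
    simp [x, this]

/-- The kernel of a homomorphism from a product of at least three finitely presented groups to an
abelian group, surjective on each factor, is finitely presented. -/
theorem MonoidHom.isFinitelyPresented_ker_of_pi [Finite ι] [DecidableEq ι]
    (hΓ : ∀ i, Group.IsFinitelyPresented (Γ i)) {i₀ i₁ i₂ : ι} (h01 : i₀ ≠ i₁) (h02 : i₀ ≠ i₂)
    (h12 : i₁ ≠ i₂) (ψ : (∀ i, Γ i) →* A)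
    (hψ : ∀ i, Function.Surjective (ψ.comp (MonoidHom.mulSingle Γ i))) :
    Group.IsFinitelyPresented ψ.ker := by
  let p := ψ.kerRestrict {i | i ≠ i₀}
  let q : ψ.ker →* Γ i₀ := (Pi.evalMonoidHom Γ i₀).comp ψ.ker.subtype
  have hG := Group.IsFinitelyPresented.pi (fun j : {i | i ≠ i₀} => Γ j) fun j => hΓ j
  have hp : Function.Surjective p := ψ.kerRestrict_surjective (k := i₀) (by simp) (hψ i₀)
  have hq : Function.Surjective q := fun y => by
    obtain ⟨x, hx⟩ := ψ.kerRestrict_surjective (s := {i₁}ᶜ) (k := i₁) (by simp) (hψ i₁)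
      (fun j => if h : j.1 = i₀ then h ▸ y else 1)
    refine ⟨x, ?_⟩
    have := congrFun hx ⟨i₀, h01⟩
    simpa [q] using this
  have := hΓ i₀
  have := hΓ i₁
  refine Group.IsFinitelyPresented.of_subdirect p q hp hq ?_ ?_ ?_
  · rw [eq_bot_iff]
    rintro x ⟨hxp, hxq⟩
    ext i
    by_cases hi : i = i₀
    · subst hi
      exact hxq
    · exact congrFun hxp ⟨i, hi⟩
  · intro a b
    let l : ψ.ker := ⟨MonoidHom.mulSingle Γ i₀ ⁅a.1 i₀, b.1 i₀⁆, by
      rw [MonoidHom.mem_ker, map_commutatorElement, map_commutatorElement,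
        commutatorElement_eq_one_iff_mul_comm, mul_comm]⟩
    have hlp : l ∈ p.ker := by
      rw [MonoidHom.mem_ker]
      ext j
      exact Pi.mulSingle_eq_of_ne j.2 _
    have hlq : ⁅a, b⁆ * l⁻¹ ∈ q.ker := by
      rw [MonoidHom.mem_ker, map_mul, map_inv, map_commutatorElement, mul_inv_eq_one]
      exact (Pi.mulSingle_eq_same i₀ ⁅a.1 i₀, b.1 i₀⁆).symm
    simpa using mul_mem (mem_sup_right (S := p.ker) hlq) (mem_sup_left hlp)
  · let s : Set ι := {i | i ≠ i₀ ∧ i ≠ i₁}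
    let u : q.ker →* Γ i₁ := ((Pi.evalMonoidHom Γ i₁).comp ψ.ker.subtype).comp q.ker.subtype
    let v : q.ker →* ∀ j : s, Γ j := (ψ.kerRestrict s).comp q.ker.subtype
    have hQ := Group.IsFinitelyPresented.pi (fun j : s => Γ j) fun j => hΓ j
    have hPfg : Group.FG (Γ i₁) := Group.IsFinitelyPresented.group_fg
    have hQfg : Group.FG (∀ j : s, Γ j) := hQ.group_fg
    have hu : Function.Surjective u := fun y => by
      obtain ⟨x, hx⟩ := ψ.kerRestrict_surjective (s := {i₂}ᶜ) (k := i₂) (by simp) (hψ i₂)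
        (fun j => if h : j.1 = i₁ then h ▸ y else 1)
      have h0 := congrFun hx ⟨i₀, h02⟩
      have h1 := congrFun hx ⟨i₁, h12⟩
      exact ⟨⟨x, by simpa [q, h01] using h0⟩, by simpa [u] using h1⟩
    have hv : Function.Surjective v := fun y => by
      classical
      obtain ⟨x, hx⟩ := ψ.kerRestrict_surjective (s := {i₁}ᶜ) (k := i₁) (by simp) (hψ i₁)
        (fun j => if h : j.1 ∈ s then y ⟨j, h⟩ else 1)
      have h0 := congrFun hx ⟨i₀, h01⟩
      refine ⟨⟨x, by simpa [q, s] using h0⟩, ?_⟩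
      ext j
      exact (congrFun hx ⟨j, j.2.2⟩).trans (dif_pos j.2)
    have huv : u.ker ⊓ v.ker = ⊥ := by
      rw [eq_bot_iff]
      rintro x ⟨hxu, hxv⟩
      ext i
      by_cases hi : i = i₀
      · subst hi
        exact x.2
      by_cases hi' : i = i₁
      · subst hi'
        exact hxu
      · exact congrFun hxv ⟨i, hi, hi'⟩
    refine (Group.fg_iff_subgroup_fg _).1 (Group.fg_of_subdirect u v hu hv huv ?_)
    have hmap : v.ker.map u = (ψ.comp (MonoidHom.mulSingle Γ i₁)).ker := by
      ext γ
      constructor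
      · rintro ⟨x, hx, rfl⟩
        have : MonoidHom.mulSingle Γ i₁ (u x) = x.1.1 := by
          ext i
          by_cases hi' : i = i₁
          · subst hi'
            simp [u]
          rw [MonoidHom.mulSingle_apply, Pi.mulSingle_eq_of_ne hi']
          by_cases hi : i = i₀
          · subst hi
            exact x.2.symm
          · exact (congrFun hx ⟨i, hi, hi'⟩).symm
        rw [MonoidHom.mem_ker, MonoidHom.comp_apply, this]
        exact x.1.2
      · intro hγ
        refine ⟨⟨⟨MonoidHom.mulSingle Γ i₁ γ, hγ⟩, ?_⟩, ?_, ?_⟩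
        · exact Pi.mulSingle_eq_of_ne h01 _
        · ext j
          exact Pi.mulSingle_eq_of_ne j.2.2 _
        · exact Pi.mulSingle_eq_same _ _
    rw [hmap]
    exact MonoidHom.isFinitelyNormallyGenerated_ker_of_comm _

end Product

section VirtuallyCoabelian

theorem Subgroup.finiteIndex_comap {G G' : Type*} [Group G] [Group G'] (K : Subgroup G)
    [hK : K.FiniteIndex] (f : G' →* G) : (K.comap f).FiniteIndex :=
  ⟨fun h => hK.index_ne_zero (index_eq_zero_of_relIndex_eq_zero ((index_comap K f).symm.trans h))⟩

theorem Subgroup.relIndex_sup_ne_zero_of_normal {G : Type*} [Group G] {R Y : Subgroup G} [R.Normal]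
    (h : Y.relIndex R ≠ 0) : Y.relIndex (R ⊔ Y) ≠ 0 := by
  have hfin : Finite (R ⧸ Y.subgroupOf R) :=
    @finite_quotient_of_finiteIndex _ _ _ ⟨h⟩
  have hsurj : Function.Surjective
      (quotientSubgroupOfEmbeddingOfLE Y (le_sup_left : R ≤ R ⊔ Y)) := by
    intro z
    obtain ⟨⟨z, hz⟩, rfl⟩ := QuotientGroup.mk_surjective z
    obtain ⟨r, hr, y, hy, rfl⟩ := mem_sup_of_normal_left.1 hz
    refine ⟨QuotientGroup.mk ⟨r, hr⟩, ?_⟩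
    rw [quotientSubgroupOfEmbeddingOfLE_apply_mk, QuotientGroup.eq]
    simpa [mem_subgroupOf] using hy
  have := Finite.of_surjective _ hsurj
  exact (finiteIndex_of_finite_quotient (H := Y.subgroupOf (R ⊔ Y))).index_ne_zero

theorem Subgroup.finiteIndex_inf_sup {G : Type*} [Group G] (R D H : Subgroup G) [R.Normal]
    [D.FiniteIndex] (h : (R ⊔ H).FiniteIndex) : (R ⊓ D ⊔ H).FiniteIndex := by
  have h1 : (R ⊓ D ⊔ H).relIndex R ≠ 0 := fun h0 =>
    (instFiniteIndex_subgroupOf D R).index_ne_zero <| by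
      have := relIndex_eq_zero_of_le_left (L := R) (le_sup_left : R ⊓ D ≤ R ⊓ D ⊔ H) h0
      rwa [inf_relIndex_left] at this
  have h2 := relIndex_sup_ne_zero_of_normal h1
  rw [← sup_assoc, sup_inf_self] at h2
  refine ⟨?_⟩
  rw [← relIndex_mul_index (sup_le_sup_right inf_le_left H : R ⊓ D ⊔ H ≤ R ⊔ H)]
  exact mul_ne_zero h2 h.index_ne_zero

variable {ι : Type*} {Γ : ι → Type*} [∀ i, Group (Γ i)]

theorem MonoidHom.normal_range_mulSingle [DecidableEq ι] (i : ι) :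
    (MonoidHom.mulSingle Γ i).range.Normal := by
  refine ⟨?_⟩
  rintro _ ⟨γ, rfl⟩ g
  refine ⟨g i * γ * (g i)⁻¹, ?_⟩
  ext j
  by_cases hj : j = i
  · subst hj
    simp
  · simp [hj]

/-- A virtually-full, virtually-coabelian subgroup of a direct product of at least three finitely
presented groups is finitely presented. -/
theorem Group.IsFinitelyPresented.of_virtuallyFull_of_virtuallyCoabelian [Finite ι] [DecidableEq ι]
    (hΓ : ∀ i, Group.IsFinitelyPresented (Γ i)) {i₀ i₁ i₂ : ι} (h01 : i₀ ≠ i₁) (h02 : i₀ ≠ i₂)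
    (h12 : i₁ ≠ i₂) (H : Subgroup (∀ i, Γ i))
    (hfull : ∀ i, ((MonoidHom.mulSingle Γ i).range ⊔ H).FiniteIndex)
    (D : Subgroup (∀ i, Γ i)) [D.Normal] [D.FiniteIndex] (hD : ⁅D, D⁆ ≤ H) :
    Group.IsFinitelyPresented H := by
  let N : Subgroup D := H.subgroupOf D
  have hN : commutator D ≤ N := by
    rw [commutator_def, commutator_le]
    exact fun a _ b _ => hD (commutator_mem_commutator a.2 b.2)
  let φ : D →* Abelianization D ⧸ N.map Abelianization.of :=
    (QuotientGroup.mk' _).comp Abelianization.of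
  have hφ : Function.Surjective φ :=
    (QuotientGroup.mk'_surjective _).comp QuotientGroup.mk_surjective
  have hφker : φ.ker = N := by
    rw [← MonoidHom.comap_ker, QuotientGroup.ker_mk', comap_map_eq, Abelianization.ker_of,
      sup_eq_left.2 hN]
  let R : ι → Subgroup (∀ i, Γ i) := fun i => (MonoidHom.mulSingle Γ i).range
  let A : ι → Subgroup (Abelianization D ⧸ N.map Abelianization.of) := fun i =>
    ((R i).subgroupOf D).map φ
  have hA : ∀ i, (A i).FiniteIndex := fun i => by
    have hR : (R i).Normal := MonoidHom.normal_range_mulSingle i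
    have hfi := Subgroup.finiteIndex_inf_sup (R i) D H (hfull i)
    have hle : (R i ⊓ D ⊔ H).subgroupOf D ≤ (A i).comap φ := by
      intro z hz
      obtain ⟨x, ⟨hxR, hxD⟩, h, hh, hxh⟩ := mem_sup_of_normal_left.1 hz
      have hker : (⟨x, hxD⟩ : D)⁻¹ * z ∈ φ.ker := by
        rw [hφker, mem_subgroupOf]
        change x⁻¹ * (z : ∀ i, Γ i) ∈ H
        rwa [← show x * h = z from hxh, inv_mul_cancel_left]
      refine ⟨⟨x, hxD⟩, hxR, ?_⟩
      rw [MonoidHom.mem_ker, map_mul, map_inv, inv_mul_eq_one] at hker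
      exact hker
    refine ⟨?_⟩
    rw [← index_comap_of_surjective _ hφ]
    exact (finiteIndex_of_le hle).index_ne_zero
  let B : Subgroup (Abelianization D ⧸ N.map Abelianization.of) := ⨅ i, A i
  have hB : B.FiniteIndex := finiteIndex_iInf hA
  let K : Subgroup (∀ i, Γ i) := (B.comap φ).map D.subtype
  have hK : K.FiniteIndex := by
    have := B.finiteIndex_comap φ
    refine ⟨?_⟩
    rw [index_map_subtype]
    exact mul_ne_zero FiniteIndex.index_ne_zero FiniteIndex.index_ne_zero
  let Λ : ∀ i, Subgroup (Γ i) := fun i => K.comap (MonoidHom.mulSingle Γ i)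
  have hΛ : ∀ i, (Λ i).FiniteIndex := fun i => K.finiteIndex_comap _
  have hΛfp : ∀ i, Group.IsFinitelyPresented (Λ i) := fun i => by
    have := hΓ i
    exact Group.IsFinitelyPresented.of_finiteIndex (Λ i)
  let incl : (∀ i, Λ i) →* ∀ i, Γ i :=
    MonoidHom.pi fun i => (Λ i).subtype.comp (Pi.evalMonoidHom _ i)
  have hincl : ∀ x, incl x ∈ K := fun x => pi_mem_of_mulSingle_mem _ fun i => (x i).2
  have hKD : ∀ x ∈ K, ∃ h : x ∈ D, φ ⟨x, h⟩ ∈ B := by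
    rintro _ ⟨x, hx, rfl⟩
    exact ⟨x.2, hx⟩
  let inclD : (∀ i, Λ i) →* D := incl.codRestrict D fun x => (hKD _ (hincl x)).1
  let ψ : (∀ i, Λ i) →* B := (φ.comp inclD).codRestrict B fun x => (hKD _ (hincl x)).2
  have hψ : ∀ i, Function.Surjective (ψ.comp (MonoidHom.mulSingle (fun i => Λ i) i)) := by
    rintro i ⟨b, hb⟩
    obtain ⟨⟨_, hxD⟩, ⟨γ, rfl⟩, hxb⟩ := mem_iInf.1 hb i
    have hγ : γ ∈ Λ i := ⟨⟨_, hxD⟩, mem_comap.2 (hxb.symm ▸ hb), rfl⟩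
    refine ⟨⟨γ, hγ⟩, Subtype.ext ?_⟩
    refine (congrArg φ (Subtype.ext ?_)).trans hxb
    ext j
    by_cases hj : j = i
    · subst hj
      simp [inclD, incl]
    · simp [inclD, incl, hj]
  have hker : ∀ x, x ∈ ψ.ker ↔ incl x ∈ H := fun x => by
    have h : x ∈ ψ.ker ↔ inclD x ∈ φ.ker := Subtype.ext_iff
    rw [h, hφker]
    rfl
  have hfp := MonoidHom.isFinitelyPresented_ker_of_pi hΛfp h01 h02 h12 ψ hψ
  let P : Subgroup (∀ i, Γ i) := ⨅ i, (Λ i).comap (Pi.evalMonoidHom Γ i)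
  have hP : P.FiniteIndex := finiteIndex_iInf fun i => (Λ i).finiteIndex_comap _
  have hmemP : ∀ x, x ∈ P ↔ ∀ i, x i ∈ Λ i := fun x => mem_iInf
  let e : ψ.ker ≃* P.subgroupOf H :=
    { toFun := fun x => ⟨⟨incl x, (hker x).1 x.2⟩, (hmemP _).2 fun i => (x.1 i).2⟩
      invFun := fun y => ⟨fun i => ⟨y.1.1 i, (hmemP _).1 y.2 i⟩, (hker _).2 y.1.2⟩
      left_inv := fun _ => rfl
      right_inv := fun _ => rfl
      map_mul' := fun _ _ => rfl }
  have := Group.IsFinitelyPresented.equiv e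
  exact Group.IsFinitelyPresented.of_finiteIndex_subgroup (P.subgroupOf H)

end VirtuallyCoabelian

/-- A virtually-full, virtually-coabelian subgroup of a direct product of `n ≥ 3` finitely
presented groups is finitely presented. -/
theorem virtuallyFull_virtuallyCoabelian_fp
    (n : ℕ) (hn : 3 ≤ n) (Γ : Fin n → Type) [∀ i, Group (Γ i)]
    (hfp : ∀ i, FinitelyPresentedGroup (Γ i))
    (H : Subgroup (∀ i, Γ i))
    (hfull : ∀ i, ((MonoidHom.mulSingle Γ i).range ⊔ H).FiniteIndex)
    (hcoab : ∃ D' : Subgroup (∀ i, Γ i), D'.FiniteIndex ∧ ⁅D', D'⁆ ≤ H) :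
    FinitelyPresentedGroup H := by
  obtain ⟨D, hD, hDH⟩ := hcoab
  have h01 : (⟨0, by omega⟩ : Fin n) ≠ ⟨1, by omega⟩ := by simp
  have h02 : (⟨0, by omega⟩ : Fin n) ≠ ⟨2, by omega⟩ := by simp
  have h12 : (⟨1, by omega⟩ : Fin n) ≠ ⟨2, by omega⟩ := by simp
  exact finitelyPresentedGroup_iff.2 <|
    Group.IsFinitelyPresented.of_virtuallyFull_of_virtuallyCoabelian
      (fun i => finitelyPresentedGroup_iff.1 (hfp i)) h01 h02 h12 H hfull D.normalCore
      ((commutator_mono D.normalCore_le D.normalCore_le).trans hDH)
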